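/- arXiv:1203.6561 — 2 statements merged into one kernel-verified Lean document; each statement's English description precedes it below -/
import Mathlib

section
/- One combinatorial failure allows at most one constructive failure. Let ⟨G,m⟩ be a gain graph such that |E| = 2|V| − 2, every subgraph (V',E') with V' nonempty satisfies |E'| ≤ 2|V'| − 2, and m is constructive; let v₀ be a 3-valent vertex with pairwise distinct neighbours v₁, v₂, v₃ and gains m₀₁, m₀₂, m₀₃. Suppose there is a subgraph (V',E') with |E'| = 2|V'| − 2, v₀ ∉ V', and v₁, v₂ ∈ V'. Then it is not the case that both of the following hold: (a) there is a balanced subgraph (V₂₃,E₂₃) with v₂, v₃ ∈ V₂₃, v₀ ∉ V₂₃, and |E₂₃| = 2|V₂₃| − 3; and (b) there is a balanced subgraph (V₃₁,E₃₁) with v₃, v₁ ∈ V₃₁, v₀ ∉ V₃₁, and |E₃₁| = 2|V₃₁| − 3. -/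
open Finset

namespace PeriodicRigidity

/-- Cast an integer gain vector to a vector of `ℝ × ℝ`. -/
def zcast (z : ℤ × ℤ) : ℝ × ℝ := ((z.1 : ℝ), (z.2 : ℝ))

variable {V E : Type*}

/-- The rigidity row of the edge `e` of the gain graph `(t, h, m)` at the realization `p`:
its value at a vertex `v` is `d_e` if `v = t e ≠ h e`, `-d_e` if `v = h e ≠ t e`, and `0`
otherwise, where `d_e = p (t e) - p (h e) - m e`. -/
def row [DecidableEq V] (t h : E → V) (m : E → ℤ × ℤ) (p : V → ℝ × ℝ) (e : E) :
    V → ℝ × ℝ := fun v =>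
  if t e = h e then 0
  else if v = t e then p (t e) - p (h e) - zcast (m e)
  else if v = h e then -(p (t e) - p (h e) - zcast (m e))
  else 0

/-- The edges of the framework `((t, h, m), p)` are independent. -/
def Indep [DecidableEq V] (t h : E → V) (m : E → ℤ × ℤ) (p : V → ℝ × ℝ) : Prop :=
  LinearIndependent ℝ (row t h m p)

/-- `(V', E')` is a subgraph of the gain graph with tail map `t` and head map `h`. -/
def IsSubgraph (t h : E → V) (V' : Finset V) (E' : Finset E) : Prop :=
  ∀ e ∈ E', t e ∈ V' ∧ h e ∈ V'

/-- A set of edges is balanced if the gains are given by a potential on the vertices. -/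
def Balanced (t h : E → V) (m : E → ℤ × ℤ) (E' : Finset E) : Prop :=
  ∃ φ : V → ℤ × ℤ, ∀ e ∈ E', m e = φ (h e) - φ (t e)

/-- The gain assignment `m` is constructive: no subgraph `(V', E')` with `|V'| ≥ 2` and
`|E'| = 2 |V'| - 2` is balanced. -/
def Constructive (t h : E → V) (m : E → ℤ × ℤ) : Prop :=
  ∀ (V' : Finset V) (E' : Finset E), IsSubgraph t h V' E' → 2 ≤ V'.card →
    (E'.card : ℤ) = 2 * V'.card - 2 → ¬ Balanced t h m E'

/-- Relative version of `Constructive`, for the graph `(VS, ES)` inside an ambient graph. -/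
def ConstructiveOn (t h : E → V) (m : E → ℤ × ℤ) (VS : Finset V) (ES : Finset E) : Prop :=
  ∀ (V' : Finset V) (E' : Finset E), V' ⊆ VS → E' ⊆ ES → IsSubgraph t h V' E' →
    2 ≤ V'.card → (E'.card : ℤ) = 2 * V'.card - 2 → ¬ Balanced t h m E'

/-- The edge `e` is, up to reversal, an edge from `u` to `v` with gain `g`. -/
def EdgeIs (t h : E → V) (m : E → ℤ × ℤ) (e : E) (u v : V) (g : ℤ × ℤ) : Prop :=
  (t e = u ∧ h e = v ∧ m e = g) ∨ (t e = v ∧ h e = u ∧ m e = -g)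

section Subgraphs

variable {t h : E → V} {m : E → ℤ × ℤ} {V₁ V₂ : Finset V} {E₁ E₂ : Finset E}

theorem Balanced.mono (hE : E₁ ⊆ E₂) (hb : Balanced t h m E₂) : Balanced t h m E₁ := by
  obtain ⟨φ, hφ⟩ := hb
  exact ⟨φ, fun e he => hφ e (hE he)⟩

variable [DecidableEq V] [DecidableEq E]

theorem IsSubgraph.union (h₁ : IsSubgraph t h V₁ E₁) (h₂ : IsSubgraph t h V₂ E₂) :
    IsSubgraph t h (V₁ ∪ V₂) (E₁ ∪ E₂) := by
  intro e he
  rcases mem_union.1 he with he | he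
  · exact ⟨mem_union_left _ (h₁ e he).1, mem_union_left _ (h₁ e he).2⟩
  · exact ⟨mem_union_right _ (h₂ e he).1, mem_union_right _ (h₂ e he).2⟩

theorem IsSubgraph.inter (h₁ : IsSubgraph t h V₁ E₁) (h₂ : IsSubgraph t h V₂ E₂) :
    IsSubgraph t h (V₁ ∩ V₂) (E₁ ∩ E₂) := by
  intro e he
  obtain ⟨he₁, he₂⟩ := mem_inter.1 he
  exact ⟨mem_inter.2 ⟨(h₁ e he₁).1, (h₂ e he₂).1⟩, mem_inter.2 ⟨(h₁ e he₁).2, (h₂ e he₂).2⟩⟩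

/-- A subgraph avoiding a 3-valent vertex and containing its three neighbours is not tight. -/
theorem IsSubgraph.card_le_of_trivalent
    (hsub : ∀ (V' : Finset V) (E' : Finset E), IsSubgraph t h V' E' → V'.Nonempty →
        (E'.card : ℤ) ≤ 2 * V'.card - 2)
    {v₀ v₁ v₂ v₃ : V} {g₁ g₂ g₃ : ℤ × ℤ} {e₁ e₂ e₃ : E}
    (he12 : e₁ ≠ e₂) (he13 : e₁ ≠ e₃) (he23 : e₂ ≠ e₃)
    (hE1 : EdgeIs t h m e₁ v₀ v₁ g₁) (hE2 : EdgeIs t h m e₂ v₀ v₂ g₂)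
    (hE3 : EdgeIs t h m e₃ v₀ v₃ g₃) (hs : IsSubgraph t h V₁ E₁)
    (h0 : v₀ ∉ V₁) (h1 : v₁ ∈ V₁) (h2 : v₂ ∈ V₁) (h3 : v₃ ∈ V₁) :
    (E₁.card : ℤ) ≤ 2 * V₁.card - 3 := by
  have notMem {e : E} {v : V} {g : ℤ × ℤ} (he : EdgeIs t h m e v₀ v g) : e ∉ E₁ := by
    intro hmem
    rcases he with ⟨ht, -, -⟩ | ⟨-, hh, -⟩
    · exact h0 (ht ▸ (hs e hmem).1)
    · exact h0 (hh ▸ (hs e hmem).2)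
  have ends {e : E} {v : V} {g : ℤ × ℤ} (he : EdgeIs t h m e v₀ v g) (hv : v ∈ V₁) :
      t e ∈ insert v₀ V₁ ∧ h e ∈ insert v₀ V₁ := by
    rcases he with ⟨ht, hh, -⟩ | ⟨ht, hh, -⟩ <;> simp [ht, hh, hv]
  have key := hsub (insert v₀ V₁) (insert e₁ (insert e₂ (insert e₃ E₁))) (by
    intro e he
    simp only [mem_insert] at he
    rcases he with rfl | rfl | rfl | he
    · exact ends hE1 h1
    · exact ends hE2 h2
    · exact ends hE3 h3
    · exact ⟨mem_insert_of_mem (hs e he).1, mem_insert_of_mem (hs e he).2⟩)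
    (insert_nonempty _ _)
  rw [card_insert_of_notMem (by simp [he12, he13, notMem hE1]),
    card_insert_of_notMem (by simp [he23, notMem hE2]), card_insert_of_notMem (notMem hE3),
    card_insert_of_notMem h0] at key
  push_cast at key
  linarith

/-- A tight subgraph and a balanced subgraph with `|E₂| = 2 |V₂| - 3` which share a vertex and
whose union is not tight share no edge and no further vertex. -/
theorem Constructive.inter_eq_singleton (hcon : Constructive t h m)
    (hs₁ : IsSubgraph t h V₁ E₁) (hc₁ : (E₁.card : ℤ) = 2 * V₁.card - 2)
    (hs₂ : IsSubgraph t h V₂ E₂) (hb₂ : Balanced t h m E₂)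
    (hc₂ : (E₂.card : ℤ) = 2 * V₂.card - 3)
    (hsub : ∀ (V' : Finset V) (E' : Finset E), IsSubgraph t h V' E' → V'.Nonempty →
        (E'.card : ℤ) ≤ 2 * V'.card - 2)
    (hunion : ((E₁ ∪ E₂).card : ℤ) ≤ 2 * (V₁ ∪ V₂).card - 3)
    {v : V} (hv₁ : v ∈ V₁) (hv₂ : v ∈ V₂) :
    V₁ ∩ V₂ = {v} ∧ E₁ ∩ E₂ = ∅ := by
  have hv : v ∈ V₁ ∩ V₂ := mem_inter.2 ⟨hv₁, hv₂⟩
  have hle := hsub _ _ (hs₁.inter hs₂) ⟨v, hv⟩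
  have hVc := card_union_add_card_inter V₁ V₂
  have hEc := card_union_add_card_inter E₁ E₂
  have hone : (V₁ ∩ V₂).card = 1 := by
    by_contra hne
    have := card_pos.2 ⟨v, hv⟩
    exact hcon _ _ (hs₁.inter hs₂) (by lia) (by lia) (hb₂.mono inter_subset_right)
  obtain ⟨w, hw⟩ := card_eq_one.1 hone
  obtain rfl : v = w := by simpa [hw] using hv
  exact ⟨hw, card_eq_zero.1 (by lia)⟩

end Subgraphs

/-- **One combinatorial failure allows at most one constructive failure.**
In the usual setting (counts, subgraph inequality, `m` constructive, `v₀` 3-valent with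
pairwise distinct neighbours `v₁, v₂, v₃`), if some tight subgraph (`|E'| = 2 |V'| - 2`)
avoiding `v₀` contains `v₁` and `v₂`, then it is not the case that both: there is a
balanced subgraph avoiding `v₀` containing `v₂, v₃` with `|E₂₃| = 2 |V₂₃| - 3`, and there is
a balanced subgraph avoiding `v₀` containing `v₃, v₁` with `|E₃₁| = 2 |V₃₁| - 3`. -/
theorem one_comb_one_const_failure {V E : Type*} [Fintype V] [Fintype E] [DecidableEq V]
    [DecidableEq E]
    (t h : E → V) (m : E → ℤ × ℤ)
    (hE : (Fintype.card E : ℤ) = 2 * Fintype.card V - 2)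
    (hsub : ∀ (V' : Finset V) (E' : Finset E), IsSubgraph t h V' E' → V'.Nonempty →
        (E'.card : ℤ) ≤ 2 * V'.card - 2)
    (hcon : Constructive t h m)
    (v₀ v₁ v₂ v₃ : V) (m₀₁ m₀₂ m₀₃ : ℤ × ℤ) (e₁ e₂ e₃ : E)
    (he12 : e₁ ≠ e₂) (he13 : e₁ ≠ e₃) (he23 : e₂ ≠ e₃)
    (hv10 : v₁ ≠ v₀) (hv20 : v₂ ≠ v₀) (hv30 : v₃ ≠ v₀)
    (hv12 : v₁ ≠ v₂) (hv23 : v₂ ≠ v₃) (hv13 : v₁ ≠ v₃)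
    (hE1 : EdgeIs t h m e₁ v₀ v₁ m₀₁)
    (hE2 : EdgeIs t h m e₂ v₀ v₂ m₀₂)
    (hE3 : EdgeIs t h m e₃ v₀ v₃ m₀₃)
    (hval : ∀ e : E, t e = v₀ ∨ h e = v₀ → e = e₁ ∨ e = e₂ ∨ e = e₃)
    (V' : Finset V) (E' : Finset E)
    (hV' : IsSubgraph t h V' E') (hV'c : (E'.card : ℤ) = 2 * V'.card - 2)
    (hV'0 : v₀ ∉ V') (hV'1 : v₁ ∈ V') (hV'2 : v₂ ∈ V') :
    ¬ ((∃ (V₂₃ : Finset V) (E₂₃ : Finset E),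
          IsSubgraph t h V₂₃ E₂₃ ∧ Balanced t h m E₂₃ ∧
          v₂ ∈ V₂₃ ∧ v₃ ∈ V₂₃ ∧ v₀ ∉ V₂₃ ∧
          (E₂₃.card : ℤ) = 2 * V₂₃.card - 3) ∧
        (∃ (V₃₁ : Finset V) (E₃₁ : Finset E),
          IsSubgraph t h V₃₁ E₃₁ ∧ Balanced t h m E₃₁ ∧
          v₃ ∈ V₃₁ ∧ v₁ ∈ V₃₁ ∧ v₀ ∉ V₃₁ ∧
          (E₃₁.card : ℤ) = 2 * V₃₁.card - 3)) := by
  rintro ⟨⟨B, F, hB, hBb, hB2, hB3, hB0, hBc⟩, ⟨C, K, hC, hCb, hC3, hC1, hC0, hCc⟩⟩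
  have bound {W : Finset V} {D : Finset E} (hs : IsSubgraph t h W D) (h0 : v₀ ∉ W)
      (h1 : v₁ ∈ W) (h2 : v₂ ∈ W) (h3 : v₃ ∈ W) : (D.card : ℤ) ≤ 2 * W.card - 3 :=
    hs.card_le_of_trivalent hsub he12 he13 he23 hE1 hE2 hE3 h0 h1 h2 h3
  obtain ⟨hVB, hEB⟩ := hcon.inter_eq_singleton hV' hV'c hB hBb hBc hsub
    (bound (hV'.union hB) (by simp [*]) (by simp [*]) (by simp [*]) (by simp [*])) hV'2 hB2
  obtain ⟨hVC, hEC⟩ := hcon.inter_eq_singleton hV' hV'c hC hCb hCc hsub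
    (bound (hV'.union hC) (by simp [*]) (by simp [*]) (by simp [*]) (by simp [*])) hV'1 hC1
  have h1B : v₁ ∉ B := fun hmem => hv12 (by
    have : v₁ ∈ V' ∩ B := mem_inter.2 ⟨hV'1, hmem⟩
    simpa [hVB] using this)
  have hVint : (V' ∪ B) ∩ C = insert v₁ (B ∩ C) := by
    rw [union_inter_distrib_right, hVC, insert_eq]
  have hEint : (E' ∪ F) ∩ K = F ∩ K := by
    rw [union_inter_distrib_right, hEC, empty_union]
  have hVtriple := card_union_add_card_inter (V' ∪ B) C
  have hEtriple := card_union_add_card_inter (E' ∪ F) K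
  rw [hVint, card_insert_of_notMem (by simp [h1B])] at hVtriple
  rw [hEint] at hEtriple
  have hVpair := card_union_add_card_inter V' B
  have hEpair := card_union_add_card_inter E' F
  rw [hVB, card_singleton] at hVpair
  rw [hEB, card_empty] at hEpair
  have hinter := hsub _ _ (hB.inter hC) ⟨v₃, mem_inter.2 ⟨hB3, hC3⟩⟩
  have hunion := bound ((hV'.union hB).union hC)
    (by simp [*]) (by simp [*]) (by simp [*]) (by simp [*])
  lia

end PeriodicRigidity
end

section
/- Reverse edge split preserves the Laman-type conditions. Let ⟨G,m⟩ be a gain graph such that |E| = 2|V| − 2, every subgraph (V',E') with V' nonempty satisfies |E'| ≤ 2|V'| − 2, and m is constructive; let v₀ be a 3-valent vertex with neighbours v₁, v₂, v₃ (at most two of which are equal, and none equal to v₀) and gains m₀₁, m₀₂, m₀₃. Then there is a pair (i,j) ∈ {(1,2),(2,3),(3,1)} with v_i ≠ v_j such that the gain graph ⟨G₀,m₀⟩ obtained by deleting v₀ and its three incident edges and adding a single new edge from v_i to v_j with gain m₀ⱼ − m₀ᵢ satisfies: |E₀| = 2|V₀| − 2 where V₀ = V ∖ {v₀}, every subgraph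 of ⟨G₀,m₀⟩ with nonempty vertex set satisfies |E'| ≤ 2|V'| − 2, and m₀ is constructive. -/
open Finset

namespace PeriodicRigidity

variable {V E : Type*}

/-- The edge set obtained after deleting the three edges `e₁, e₂, e₃` and adding a single
new edge (indexed by `Sum.inr ()`). -/
def splitES {E : Type*} [Fintype E] [DecidableEq E] (e₁ e₂ e₃ : E) : Finset (E ⊕ Unit) :=
  ((((univ : Finset E).erase e₁).erase e₂).erase e₃).image Sum.inl ∪ {Sum.inr ()}

section ReverseSplit

variable {V E : Type*} {t h : E → V} {m : E → ℤ × ℤ}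

/-- The gains of the edges in `F` are the differences of the potential `φ`. -/
def IsPotential (t h : E → V) (m : E → ℤ × ℤ) (φ : V → ℤ × ℤ) (F : Finset E) : Prop :=
  ∀ e ∈ F, m e = φ (h e) - φ (t e)

/-- A subgraph avoiding `v₀` which obstructs the addition of an edge from `p` to `q` with gain
`mq - mp`: it is either tight, or it misses tightness by one edge and is balanced by a potential
with the values `mp` at `p` and `mq` at `q`. -/
structure Blocker (t h : E → V) (m : E → ℤ × ℤ) (v₀ p q : V) (mp mq : ℤ × ℤ)
    (W : Finset V) (F : Finset E) : Prop where
  isSubgraph : IsSubgraph t h W F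
  notMem : v₀ ∉ W
  left_mem : p ∈ W
  right_mem : q ∈ W
  count : 2 * #W ≤ #F + 2 ∨
    2 * #W ≤ #F + 3 ∧ ∃ φ, IsPotential t h m φ F ∧ φ p = mp ∧ φ q = mq

theorem IsPotential.mono {φ : V → ℤ × ℤ} {F F' : Finset E} (hF : IsPotential t h m φ F)
    (hle : F' ⊆ F) : IsPotential t h m φ F' :=
  fun e he => hF e (hle he)

theorem Blocker.two_mul_card_le {v₀ p q : V} {mp mq : ℤ × ℤ} {W : Finset V} {F : Finset E}
    (hB : Blocker t h m v₀ p q mp mq W F) : 2 * #W ≤ #F + 3 := by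
  rcases hB.count with hc | ⟨hc, -⟩ <;> omega

/-- If two potentials agree somewhere but not everywhere on a common subgraph, then that subgraph
is disconnected and so misses tightness by at least two edges. -/
theorem card_add_four_le_of_disagree
    (hsub : ∀ (W : Finset V) (F : Finset E), IsSubgraph t h W F → W.Nonempty →
      #F + 2 ≤ 2 * #W)
    {φ φ' : V → ℤ × ℤ} {W : Finset V} {F : Finset E} (hW : IsSubgraph t h W F)
    (hφ : IsPotential t h m φ F) (hφ' : IsPotential t h m φ' F)
    {x y : V} (hx : x ∈ W) (hxe : φ x = φ' x) (hy : y ∈ W) (hye : φ y ≠ φ' y) :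
    #F + 4 ≤ 2 * #W := by
  have hiff : ∀ e ∈ F, (φ (t e) = φ' (t e) ↔ φ (h e) = φ' (h e)) := by
    intro e he
    have h1 := (hφ e he).symm.trans (hφ' e he)
    constructor <;> intro h2
    · rw [h2] at h1
      exact sub_left_injective h1
    · rw [h2] at h1
      exact sub_right_injective h1
  have hS := hsub (W.filter fun v => φ v = φ' v) (F.filter fun e => φ (t e) = φ' (t e))
    (fun e he => by
      obtain ⟨heF, he⟩ := mem_filter.1 he
      exact ⟨mem_filter.2 ⟨(hW e heF).1, he⟩, mem_filter.2 ⟨(hW e heF).2, (hiff e heF).1 he⟩⟩)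
    ⟨x, mem_filter.2 ⟨hx, hxe⟩⟩
  have hT := hsub (W.filter fun v => ¬ φ v = φ' v) (F.filter fun e => ¬ φ (t e) = φ' (t e))
    (fun e he => by
      obtain ⟨heF, he⟩ := mem_filter.1 he
      exact ⟨mem_filter.2 ⟨(hW e heF).1, he⟩,
        mem_filter.2 ⟨(hW e heF).2, fun hh => he ((hiff e heF).2 hh)⟩⟩)
    ⟨y, mem_filter.2 ⟨hy, hye⟩⟩
  have hcW := card_filter_add_card_filter_not (s := W) (fun v => φ v = φ' v)
  have hcF := card_filter_add_card_filter_not (s := F) (fun e => φ (t e) = φ' (t e))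
  omega

theorem EdgeIs.notMem {e : E} {v₀ v : V} {g : ℤ × ℤ} (he : EdgeIs t h m e v₀ v g)
    {U : Finset V} {F : Finset E} (hF : IsSubgraph t h U F) (hv : v₀ ∉ U) : e ∉ F := by
  intro heF
  rcases he with ⟨ht, -⟩ | ⟨-, hh, -⟩
  · exact hv (ht ▸ (hF e heF).1)
  · exact hv (hh ▸ (hF e heF).2)

variable [DecidableEq V]

theorem IsPotential.exists_glue [DecidableEq E] {φ φ' : V → ℤ × ℤ} {W W' : Finset V}
    {F F' : Finset E}
    (hW : IsSubgraph t h W F) (hW' : IsSubgraph t h W' F') (hφ : IsPotential t h m φ F)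
    (hφ' : IsPotential t h m φ' F') (hagree : ∀ x ∈ W, x ∈ W' → φ x = φ' x) :
    ∃ ψ, IsPotential t h m ψ (F ∪ F') ∧ (∀ x ∈ W, ψ x = φ x) ∧ ∀ x ∈ W', ψ x = φ' x := by
  have h1 : ∀ x ∈ W, W.piecewise φ φ' x = φ x := fun x hx => by simp [hx]
  have h2 : ∀ x ∈ W', W.piecewise φ φ' x = φ' x := fun x hx => by
    by_cases hxW : x ∈ W
    · rw [h1 x hxW, hagree x hxW hx]
    · simp [hxW]
  refine ⟨W.piecewise φ φ', fun e he => ?_, h1, h2⟩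
  rcases mem_union.1 he with he | he
  · rw [h1 _ (hW e he).1, h1 _ (hW e he).2, hφ e he]
  · rw [h2 _ (hW' e he).1, h2 _ (hW' e he).2, hφ' e he]

theorem IsSubgraph.union_s18 [DecidableEq E] {W W' : Finset V} {F F' : Finset E}
    (hW : IsSubgraph t h W F) (hW' : IsSubgraph t h W' F') :
    IsSubgraph t h (W ∪ W') (F ∪ F') := by
  intro e he
  rcases mem_union.1 he with he | he
  · exact ⟨mem_union_left _ (hW e he).1, mem_union_left _ (hW e he).2⟩
  · exact ⟨mem_union_right _ (hW' e he).1, mem_union_right _ (hW' e he).2⟩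

theorem IsSubgraph.inter_s18 [DecidableEq E] {W W' : Finset V} {F F' : Finset E}
    (hW : IsSubgraph t h W F) (hW' : IsSubgraph t h W' F') :
    IsSubgraph t h (W ∩ W') (F ∩ F') := fun e he =>
  have he' := mem_inter.1 he
  ⟨mem_inter.2 ⟨(hW e he'.1).1, (hW' e he'.2).1⟩, mem_inter.2 ⟨(hW e he'.1).2, (hW' e he'.2).2⟩⟩

theorem EdgeIs.mem_insert {e : E} {v₀ v : V} {g : ℤ × ℤ} (he : EdgeIs t h m e v₀ v g)
    {U : Finset V} (hv : v ∈ U) : t e ∈ insert v₀ U ∧ h e ∈ insert v₀ U := by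
  rcases he with ⟨ht, hh, -⟩ | ⟨ht, hh, -⟩ <;> simp [ht, hh, hv]

theorem EdgeIs.gain_eq_update {e : E} {v₀ v : V} {g : ℤ × ℤ} (he : EdgeIs t h m e v₀ v g)
    (hv : v ≠ v₀) {φ : V → ℤ × ℤ} (hφ : φ v = g) :
    m e = Function.update φ v₀ 0 (h e) - Function.update φ v₀ 0 (t e) := by
  rcases he with ⟨ht, hh, hm⟩ | ⟨ht, hh, hm⟩ <;> simp [ht, hh, hm, hv, hφ]

variable [DecidableEq E]

theorem Blocker.inter_eq_singleton {v₀ p q r : V} {mp mq mr : ℤ × ℤ}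
    (hsub : ∀ (W : Finset V) (F : Finset E), IsSubgraph t h W F → W.Nonempty →
      #F + 2 ≤ 2 * #W)
    (hbal : ∀ (W : Finset V) (F : Finset E) (φ : V → ℤ × ℤ), IsSubgraph t h W F → 2 ≤ #W →
      IsPotential t h m φ F → #F + 3 ≤ 2 * #W)
    (hext : ∀ (U : Finset V) (F : Finset E), IsSubgraph t h U F → v₀ ∉ U → p ∈ U → q ∈ U →
      r ∈ U → #F + 3 ≤ 2 * #U)
    (hextBal : ∀ (U : Finset V) (F : Finset E) (φ : V → ℤ × ℤ), IsSubgraph t h U F → v₀ ∉ U →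
      p ∈ U → q ∈ U → r ∈ U → IsPotential t h m φ F → φ p = mp → φ q = mq → φ r = mr →
      #F + 4 ≤ 2 * #U)
    {W W' : Finset V} {F F' : Finset E} (hB : Blocker t h m v₀ p q mp mq W F)
    (hB' : Blocker t h m v₀ q r mq mr W' F') : W ∩ W' = {q} := by
  have hq : q ∈ W ∩ W' := mem_inter.2 ⟨hB.right_mem, hB'.left_mem⟩
  by_contra hne
  have htwo : 2 ≤ #(W ∩ W') := by
    have h0 : 0 < #(W ∩ W') := card_pos.2 ⟨q, hq⟩
    have h1 : #(W ∩ W') ≠ 1 := by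
      intro h1
      obtain ⟨x, hx⟩ := card_eq_one.1 h1
      rw [hx, mem_singleton] at hq
      exact hne (hq ▸ hx)
    omega
  have hU := hB.isSubgraph.union_s18 hB'.isSubgraph
  have hI := hB.isSubgraph.inter_s18 hB'.isSubgraph
  have hv : v₀ ∉ W ∪ W' := by simp [hB.notMem, hB'.notMem]
  have hpU : p ∈ W ∪ W' := mem_union_left _ hB.left_mem
  have hqU : q ∈ W ∪ W' := mem_union_left _ hB.right_mem
  have hrU : r ∈ W ∪ W' := mem_union_right _ hB'.right_mem
  have hcU := hext _ _ hU hv hpU hqU hrU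
  have hcI := hsub _ _ hI ⟨q, hq⟩
  have hcW := card_union_add_card_inter W W'
  have hcF := card_union_add_card_inter F F'
  rcases hB.count with hc | ⟨hc, φ, hφ, hp, hφq⟩ <;>
    rcases hB'.count with hc' | ⟨hc', φ', hφ', hφq', hr⟩
  · omega
  · have := hbal _ _ _ hI htwo (hφ'.mono inter_subset_right)
    omega
  · have := hbal _ _ _ hI htwo (hφ.mono inter_subset_left)
    omega
  · by_cases hag : ∀ x ∈ W, x ∈ W' → φ x = φ' x
    · obtain ⟨ψ, hψ, h1, h2⟩ := hφ.exists_glue hB.isSubgraph hB'.isSubgraph hφ' hag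
      have := hbal _ _ _ hI htwo (hφ.mono inter_subset_left)
      have := hextBal _ _ ψ hU hv hpU hqU hrU hψ ((h1 p hB.left_mem).trans hp)
        ((h1 q hB.right_mem).trans hφq) ((h2 r hB'.right_mem).trans hr)
      omega
    · push Not at hag
      obtain ⟨y, hyW, hyW', hy⟩ := hag
      have := card_add_four_le_of_disagree hsub hI (hφ.mono inter_subset_left)
        (hφ'.mono inter_subset_right) hq (hφq.trans hφq'.symm) (mem_inter.2 ⟨hyW, hyW'⟩) hy
      omega

/-- Three blockers for the pairs of three distinct vertices cannot pairwise meet in just the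
common vertex. -/
theorem Blocker.false_of_triangle {v₀ p q r : V} {mp mq mr : ℤ × ℤ}
    (hpq : p ≠ q) (hqr : q ≠ r) (hrp : r ≠ p)
    (hsub : ∀ (W : Finset V) (F : Finset E), IsSubgraph t h W F → W.Nonempty →
      #F + 2 ≤ 2 * #W)
    (hext : ∀ (U : Finset V) (F : Finset E), IsSubgraph t h U F → v₀ ∉ U → p ∈ U → q ∈ U →
      r ∈ U → #F + 3 ≤ 2 * #U)
    (hextBal : ∀ (U : Finset V) (F : Finset E) (φ : V → ℤ × ℤ), IsSubgraph t h U F → v₀ ∉ U →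
      p ∈ U → q ∈ U → r ∈ U → IsPotential t h m φ F → φ p = mp → φ q = mq → φ r = mr →
      #F + 4 ≤ 2 * #U)
    {W₁ W₂ W₃ : Finset V} {F₁ F₂ F₃ : Finset E} (hB₁ : Blocker t h m v₀ p q mp mq W₁ F₁)
    (hB₂ : Blocker t h m v₀ q r mq mr W₂ F₂) (hB₃ : Blocker t h m v₀ r p mr mp W₃ F₃)
    (h₁₂ : W₁ ∩ W₂ = {q}) (h₂₃ : W₂ ∩ W₃ = {r}) (h₃₁ : W₃ ∩ W₁ = {p}) : False := by
  have hU₁₂ := hB₁.isSubgraph.union_s18 hB₂.isSubgraph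
  have hU := hU₁₂.union_s18 hB₃.isSubgraph
  have hv : v₀ ∉ W₁ ∪ W₂ ∪ W₃ := by simp [hB₁.notMem, hB₂.notMem, hB₃.notMem]
  have hpU : p ∈ W₁ ∪ W₂ ∪ W₃ := by simp [hB₁.left_mem]
  have hqU : q ∈ W₁ ∪ W₂ ∪ W₃ := by simp [hB₂.left_mem]
  have hrU : r ∈ W₁ ∪ W₂ ∪ W₃ := by simp [hB₃.left_mem]
  have hinter : (W₁ ∪ W₂) ∩ W₃ = {p, r} := by
    rw [union_inter_distrib_right, inter_comm W₁, h₃₁, h₂₃]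
    rfl
  have hcW₁₂ := card_union_add_card_inter W₁ W₂
  have hcW := card_union_add_card_inter (W₁ ∪ W₂) W₃
  rw [h₁₂, card_singleton] at hcW₁₂
  rw [hinter, card_pair hrp.symm] at hcW
  have hempty : ∀ {W W' : Finset V} {F F' : Finset E} {x : V}, IsSubgraph t h W F →
      IsSubgraph t h W' F' → W ∩ W' = {x} → #(F ∩ F') = 0 := by
    intro W W' F F' x hW hW' hx
    have := hsub _ _ (hW.inter_s18 hW') (hx ▸ singleton_nonempty x)
    rw [hx, card_singleton] at this
    omega
  have hI₁₂ := hempty hB₁.isSubgraph hB₂.isSubgraph h₁₂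
  have hI₂₃ := hempty hB₂.isSubgraph hB₃.isSubgraph h₂₃
  have hI₃₁ := hempty hB₃.isSubgraph hB₁.isSubgraph h₃₁
  have hcF₁₂ := card_union_add_card_inter F₁ F₂
  have hcF := card_union_add_card_inter (F₁ ∪ F₂) F₃
  rw [union_inter_distrib_right, inter_comm F₁ F₃, card_eq_zero.1 hI₃₁, card_eq_zero.1 hI₂₃,
    union_empty, card_empty] at hcF
  have hcU := hext _ _ hU hv hpU hqU hrU
  have hc₁' := hB₁.two_mul_card_le
  have hc₂' := hB₂.two_mul_card_le
  have hc₃' := hB₃.two_mul_card_le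
  rcases hB₁.count with hc₁ | ⟨-, φ₁, hφ₁, hp₁, hq₁⟩
  · omega
  rcases hB₂.count with hc₂ | ⟨-, φ₂, hφ₂, hq₂, hr₂⟩
  · omega
  rcases hB₃.count with hc₃ | ⟨-, φ₃, hφ₃, hr₃, hp₃⟩
  · omega
  obtain ⟨ψ, hψ, hψ₁, hψ₂⟩ := hφ₁.exists_glue hB₁.isSubgraph hB₂.isSubgraph hφ₂ (by
    intro x hx hx'
    have hxq : x ∈ W₁ ∩ W₂ := mem_inter.2 ⟨hx, hx'⟩
    rw [h₁₂, mem_singleton] at hxq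
    rw [hxq, hq₁, hq₂])
  have hψp : ψ p = mp := (hψ₁ p hB₁.left_mem).trans hp₁
  have hψq : ψ q = mq := (hψ₁ q hB₁.right_mem).trans hq₁
  have hψr : ψ r = mr := (hψ₂ r hB₂.right_mem).trans hr₂
  obtain ⟨χ, hχ, hχ₁, -⟩ := hψ.exists_glue hU₁₂ hB₃.isSubgraph hφ₃ (by
    intro x hx hx'
    have hxpr : x ∈ (W₁ ∪ W₂) ∩ W₃ := mem_inter.2 ⟨hx, hx'⟩
    rw [hinter, mem_insert, mem_singleton] at hxpr
    rcases hxpr with rfl | rfl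
    · rw [hψp, hp₃]
    · rw [hψr, hr₃])
  have := hextBal _ _ χ hU hv hpU hqU hrU hχ
    ((hχ₁ p (mem_union_left _ hB₁.left_mem)).trans hψp)
    ((hχ₁ q (mem_union_left _ hB₁.right_mem)).trans hψq)
    ((hχ₁ r (mem_union_right _ hB₂.right_mem)).trans hψr)
  omega

/-- If adding an edge from `p` to `q` with gain `mq - mp` destroys sparsity or constructivity,
then there is a blocker. -/
theorem exists_blocker [Fintype V] [Fintype E] {v₀ p q : V} {mp mq : ℤ × ℤ} {e₁ e₂ e₃ : E}
    (hsub : ∀ (W : Finset V) (F : Finset E), IsSubgraph t h W F → W.Nonempty →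
      #F + 2 ≤ 2 * #W)
    (hbal : ∀ (W : Finset V) (F : Finset E) (φ : V → ℤ × ℤ), IsSubgraph t h W F → 2 ≤ #W →
      IsPotential t h m φ F → #F + 3 ≤ 2 * #W)
    (hnot : ¬ ((∀ (V' : Finset V) (E' : Finset (E ⊕ Unit)),
        V' ⊆ (univ : Finset V).erase v₀ → E' ⊆ splitES e₁ e₂ e₃ →
        IsSubgraph (Sum.elim t fun _ => p) (Sum.elim h fun _ => q) V' E' →
        V'.Nonempty → (E'.card : ℤ) ≤ 2 * V'.card - 2) ∧
      ConstructiveOn (Sum.elim t fun _ => p) (Sum.elim h fun _ => q)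
        (Sum.elim m fun _ => mq - mp) ((univ : Finset V).erase v₀) (splitES e₁ e₂ e₃))) :
    ∃ W F, Blocker t h m v₀ p q mp mq W F := by
  have hleft : ∀ {V' : Finset V} {E' : Finset (E ⊕ Unit)},
      IsSubgraph (Sum.elim t fun _ => p) (Sum.elim h fun _ => q) V' E' →
      IsSubgraph t h V' E'.toLeft :=
    fun hE' e he => hE' (Sum.inl e) (mem_toLeft.1 he)
  have hcard : ∀ E' : Finset (E ⊕ Unit), #E' = #E'.toLeft ∧ Sum.inr () ∉ E' ∨
      #E' = #E'.toLeft + 1 ∧ Sum.inr () ∈ E' := by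
    intro E'
    have hc := card_toLeft_add_card_toRight (u := E')
    by_cases hu : Sum.inr () ∈ E'
    · have : E'.toRight = {()} := by
        ext
        simp [hu]
      rw [this, card_singleton] at hc
      exact Or.inr ⟨hc.symm, hu⟩
    · have : E'.toRight = ∅ := by
        ext
        simp [hu]
      rw [this, card_empty] at hc
      exact Or.inl ⟨hc.symm, hu⟩
  rw [not_and_or] at hnot
  rcases hnot with hnot | hnot
  · push Not at hnot
    obtain ⟨V', E', hV', -, hE', hne, hlt⟩ := hnot
    have hs := hsub _ _ (hleft hE') hne
    rcases hcard E' with ⟨hc, -⟩ | ⟨hc, hu⟩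
    · omega
    · exact ⟨V', E'.toLeft, hleft hE', fun hv => by simpa using hV' hv, (hE' _ hu).1,
        (hE' _ hu).2, Or.inl (by omega)⟩
  · unfold ConstructiveOn at hnot
    push Not at hnot
    obtain ⟨V', E', hV', -, hE', htwo, heq, φ, hφ⟩ := hnot
    have hpot : IsPotential t h m φ E'.toLeft := fun e he => hφ (Sum.inl e) (mem_toLeft.1 he)
    have hs := hbal _ _ _ (hleft hE') htwo hpot
    rcases hcard E' with ⟨hc, -⟩ | ⟨hc, hu⟩
    · omega
    · have hg : mq - mp = φ q - φ p := hφ _ hu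
      refine ⟨V', E'.toLeft, hleft hE', fun hv => by simpa using hV' hv, (hE' _ hu).1,
        (hE' _ hu).2, Or.inr ⟨by omega, fun x => φ x - φ p + mp, fun e he => ?_, ?_, ?_⟩⟩
      · simp [hpot e he]
      · simp
      · simp [← hg]

theorem card_splitES [Fintype E] {e₁ e₂ e₃ : E} (he12 : e₁ ≠ e₂) (he13 : e₁ ≠ e₃)
    (he23 : e₂ ≠ e₃) : #(splitES e₁ e₂ e₃) + 2 = Fintype.card E := by
  have h3 : #({e₁, e₂, e₃} : Finset E) = 3 := card_eq_three.2 ⟨_, _, _, he12, he13, he23, rfl⟩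
  have hle := card_le_univ ({e₁, e₂, e₃} : Finset E)
  unfold splitES
  rw [card_union_of_disjoint (by simp), card_image_of_injective _ Sum.inl_injective,
    card_erase_of_mem (by simp [he13.symm, he23.symm]), card_erase_of_mem (by simp [he12.symm]),
    card_erase_of_mem (mem_univ _), card_univ, card_singleton]
  omega

theorem card_union_three {e₁ e₂ e₃ : E} (he12 : e₁ ≠ e₂) (he13 : e₁ ≠ e₃) (he23 : e₂ ≠ e₃)
    {F : Finset E} (h1 : e₁ ∉ F) (h2 : e₂ ∉ F) (h3 : e₃ ∉ F) : #(F ∪ {e₁, e₂, e₃}) = #F + 3 := by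
  rw [card_union_of_disjoint (by simp [h1, h2, h3]),
    card_eq_three.2 ⟨_, _, _, he12, he13, he23, rfl⟩]

end ReverseSplit

/-- **Reverse edge split preserves the Laman-type conditions.**
Suppose `|E| = 2 |V| - 2`, all subgraphs satisfy `|E'| ≤ 2 |V'| - 2` and `m` is
constructive, and `v₀` is a 3-valent vertex with neighbours `v₁, v₂, v₃` (at most two
equal, none equal to `v₀`) and gains `m₀₁, m₀₂, m₀₃`. Then for some pair
`(i, j) ∈ {(1,2), (2,3), (3,1)}` with `v_i ≠ v_j`, deleting `v₀` with its three edges and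
adding a single new edge from `v_i` to `v_j` with gain `m₀ⱼ - m₀ᵢ` yields a gain graph
satisfying the count `|E₀| = 2 |V₀| - 2`, the subgraph inequality, and constructivity. -/
theorem reverse_split_preserves_laman {V E : Type*} [Fintype V] [Fintype E]
    [DecidableEq V] [DecidableEq E]
    (t h : E → V) (m : E → ℤ × ℤ)
    (hE : (Fintype.card E : ℤ) = 2 * Fintype.card V - 2)
    (hsub : ∀ (V' : Finset V) (E' : Finset E), IsSubgraph t h V' E' → V'.Nonempty →
        (E'.card : ℤ) ≤ 2 * V'.card - 2)
    (hcon : Constructive t h m)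
    (v₀ v₁ v₂ v₃ : V) (m₀₁ m₀₂ m₀₃ : ℤ × ℤ) (e₁ e₂ e₃ : E)
    (he12 : e₁ ≠ e₂) (he13 : e₁ ≠ e₃) (he23 : e₂ ≠ e₃)
    (hv10 : v₁ ≠ v₀) (hv20 : v₂ ≠ v₀) (hv30 : v₃ ≠ v₀)
    (hnotall : ¬ (v₁ = v₂ ∧ v₂ = v₃))
    (hE1 : EdgeIs t h m e₁ v₀ v₁ m₀₁)
    (hE2 : EdgeIs t h m e₂ v₀ v₂ m₀₂)
    (hE3 : EdgeIs t h m e₃ v₀ v₃ m₀₃)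
    (hval : ∀ e : E, t e = v₀ ∨ h e = v₀ → e = e₁ ∨ e = e₂ ∨ e = e₃) :
    ∃ (a b : V) (g : ℤ × ℤ),
      ((a, b, g) = (v₁, v₂, m₀₂ - m₀₁) ∨ (a, b, g) = (v₂, v₃, m₀₃ - m₀₂) ∨
        (a, b, g) = (v₃, v₁, m₀₁ - m₀₃)) ∧ a ≠ b ∧
      (((splitES e₁ e₂ e₃).card : ℤ) = 2 * ((univ : Finset V).erase v₀).card - 2) ∧
      (∀ (V' : Finset V) (E' : Finset (E ⊕ Unit)),
        V' ⊆ (univ : Finset V).erase v₀ → E' ⊆ splitES e₁ e₂ e₃ →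
        IsSubgraph (Sum.elim t fun _ => a) (Sum.elim h fun _ => b) V' E' →
        V'.Nonempty → (E'.card : ℤ) ≤ 2 * V'.card - 2) ∧
      ConstructiveOn (Sum.elim t fun _ => a) (Sum.elim h fun _ => b)
        (Sum.elim m fun _ => g) ((univ : Finset V).erase v₀) (splitES e₁ e₂ e₃) := by
  have hS : ∀ (W : Finset V) (F : Finset E), IsSubgraph t h W F → W.Nonempty →
      #F + 2 ≤ 2 * #W := by
    intro W F hF hW
    have := hsub W F hF hW
    omega
  have hbal : ∀ (W : Finset V) (F : Finset E) (φ : V → ℤ × ℤ), IsSubgraph t h W F → 2 ≤ #W →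
      IsPotential t h m φ F → #F + 3 ≤ 2 * #W := by
    intro W F φ hF hW hφ
    have h1 := hS W F hF (card_pos.1 (by omega))
    by_contra hlt
    exact hcon W F hF hW (by omega) ⟨φ, hφ⟩
  have hstar : ∀ (U : Finset V) (F : Finset E), IsSubgraph t h U F → v₁ ∈ U → v₂ ∈ U →
      v₃ ∈ U → IsSubgraph t h (insert v₀ U) (F ∪ {e₁, e₂, e₃}) := by
    intro U F hF h1 h2 h3 e he
    simp only [mem_union, Finset.mem_insert, mem_singleton] at he
    rcases he with he | rfl | rfl | rfl
    · exact ⟨mem_insert_of_mem (hF e he).1, mem_insert_of_mem (hF e he).2⟩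
    · exact hE1.mem_insert h1
    · exact hE2.mem_insert h2
    · exact hE3.mem_insert h3
  have hext : ∀ (U : Finset V) (F : Finset E), IsSubgraph t h U F → v₀ ∉ U → v₁ ∈ U →
      v₂ ∈ U → v₃ ∈ U → #F + 3 ≤ 2 * #U := by
    intro U F hF h0 h1 h2 h3
    have hc := hS _ _ (hstar U F hF h1 h2 h3) (insert_nonempty _ _)
    rw [card_insert_of_notMem h0, card_union_three he12 he13 he23 (hE1.notMem hF h0)
      (hE2.notMem hF h0) (hE3.notMem hF h0)] at hc
    omega
  have hextBal : ∀ (U : Finset V) (F : Finset E) (φ : V → ℤ × ℤ), IsSubgraph t h U F →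
      v₀ ∉ U → v₁ ∈ U → v₂ ∈ U → v₃ ∈ U → IsPotential t h m φ F → φ v₁ = m₀₁ → φ v₂ = m₀₂ →
      φ v₃ = m₀₃ → #F + 4 ≤ 2 * #U := by
    intro U F φ hF h0 h1 h2 h3 hφ hφ1 hφ2 hφ3
    have hU : 0 < #U := card_pos.2 ⟨_, h1⟩
    have hc := hbal _ _ (Function.update φ v₀ 0) (hstar U F hF h1 h2 h3)
      (by rw [card_insert_of_notMem h0]; omega) (by
        intro e he
        simp only [mem_union, Finset.mem_insert, mem_singleton] at he
        rcases he with he | rfl | rfl | rfl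
        · have ht : t e ≠ v₀ := fun hh => h0 (hh ▸ (hF e he).1)
          have hh : h e ≠ v₀ := fun hh => h0 (hh ▸ (hF e he).2)
          simp [ht, hh, hφ e he]
        · exact hE1.gain_eq_update hv10 hφ1
        · exact hE2.gain_eq_update hv20 hφ2
        · exact hE3.gain_eq_update hv30 hφ3)
    rw [card_insert_of_notMem h0, card_union_three he12 he13 he23 (hE1.notMem hF h0)
      (hE2.notMem hF h0) (hE3.notMem hF h0)] at hc
    omega
  have hcount : ((splitES e₁ e₂ e₃).card : ℤ) = 2 * ((univ : Finset V).erase v₀).card - 2 := by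
    have h1 := card_splitES he12 he13 he23
    have h2 := card_erase_add_one (mem_univ v₀)
    rw [card_univ] at h2
    omega
  by_contra hgoal
  have hblock : ∀ {p q : V} {mp mq : ℤ × ℤ},
      ((p, q, mq - mp) = (v₁, v₂, m₀₂ - m₀₁) ∨ (p, q, mq - mp) = (v₂, v₃, m₀₃ - m₀₂) ∨
        (p, q, mq - mp) = (v₃, v₁, m₀₁ - m₀₃)) → p ≠ q →
      ∃ W F, Blocker t h m v₀ p q mp mq W F := fun hmem hne =>
    exists_blocker (e₁ := e₁) (e₂ := e₂) (e₃ := e₃) hS hbal fun hgood =>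
      hgoal ⟨_, _, _, hmem, hne, hcount, hgood⟩
  have hb₁ : v₁ ≠ v₂ → ∃ W F, Blocker t h m v₀ v₁ v₂ m₀₁ m₀₂ W F := hblock (Or.inl rfl)
  have hb₂ : v₂ ≠ v₃ → ∃ W F, Blocker t h m v₀ v₂ v₃ m₀₂ m₀₃ W F :=
    hblock (Or.inr (Or.inl rfl))
  have hb₃ : v₃ ≠ v₁ → ∃ W F, Blocker t h m v₀ v₃ v₁ m₀₃ m₀₁ W F :=
    hblock (Or.inr (Or.inr rfl))
  have hi₁₂ : ∀ {W W' F F'}, Blocker t h m v₀ v₁ v₂ m₀₁ m₀₂ W F →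
      Blocker t h m v₀ v₂ v₃ m₀₂ m₀₃ W' F' → W ∩ W' = {v₂} :=
    Blocker.inter_eq_singleton hS hbal hext hextBal
  have hi₂₃ : ∀ {W W' F F'}, Blocker t h m v₀ v₂ v₃ m₀₂ m₀₃ W F →
      Blocker t h m v₀ v₃ v₁ m₀₃ m₀₁ W' F' → W ∩ W' = {v₃} :=
    Blocker.inter_eq_singleton hS hbal
      (fun U F hF h0 h2 h3 h1 => hext U F hF h0 h1 h2 h3)
      (fun U F φ hF h0 h2 h3 h1 hφ g2 g3 g1 => hextBal U F φ hF h0 h1 h2 h3 hφ g1 g2 g3)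
  have hi₃₁ : ∀ {W W' F F'}, Blocker t h m v₀ v₃ v₁ m₀₃ m₀₁ W F →
      Blocker t h m v₀ v₁ v₂ m₀₁ m₀₂ W' F' → W ∩ W' = {v₁} :=
    Blocker.inter_eq_singleton hS hbal
      (fun U F hF h0 h3 h1 h2 => hext U F hF h0 h1 h2 h3)
      (fun U F φ hF h0 h3 h1 h2 hφ g3 g1 g2 => hextBal U F φ hF h0 h1 h2 h3 hφ g1 g2 g3)
  have hcommon : ∀ {W W' : Finset V} {x y : V}, W ∩ W' = {x} → y ∈ W → y ∈ W' → y = x :=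
    fun hx hy hy' => mem_singleton.1 (hx ▸ mem_inter.2 ⟨hy, hy'⟩)
  by_cases h12 : v₁ = v₂
  · have h23 : v₂ ≠ v₃ := fun h23 => hnotall ⟨h12, h23⟩
    obtain ⟨W₂, F₂, hB₂⟩ := hb₂ h23
    obtain ⟨W₃, F₃, hB₃⟩ := hb₃ (h12 ▸ h23.symm)
    exact h23 (hcommon (hi₂₃ hB₂ hB₃) hB₂.left_mem (h12 ▸ hB₃.right_mem))
  obtain ⟨W₁, F₁, hB₁⟩ := hb₁ h12
  by_cases h23 : v₂ = v₃
  · obtain ⟨W₃, F₃, hB₃⟩ := hb₃ fun h31 => h12 (h31.symm.trans h23.symm)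
    exact h12 (hcommon (hi₃₁ hB₃ hB₁) (h23 ▸ hB₃.left_mem) hB₁.right_mem).symm
  obtain ⟨W₂, F₂, hB₂⟩ := hb₂ h23
  by_cases h31 : v₃ = v₁
  · exact h12 (hcommon (hi₁₂ hB₁ hB₂) hB₁.left_mem (h31 ▸ hB₂.right_mem))
  obtain ⟨W₃, F₃, hB₃⟩ := hb₃ h31
  exact Blocker.false_of_triangle h12 h23 h31 hS hext hextBal hB₁ hB₂ hB₃
    (hi₁₂ hB₁ hB₂) (hi₂₃ hB₂ hB₃) (hi₃₁ hB₃ hB₁)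

end PeriodicRigidity
end
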